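/- Let π = w ⊗ λ be the representation of G = (ℝ ⋊ ℝ₊) × S¹ on H = F_x⁻¹ L²(ℝ̂₊) ⊗ L²(S¹), given by π(b,a,φ)v(x,θ) = a^{−1/2} v((x−b)/a, θ−φ). A vector u = Σ_{n∈ℤ} u_n ⊗ e_n ∈ H is admissible (the voice transform is an isometry into L²(G)) if and only if ∫_{ℝ₊} |F u_n(ξ)|² dξ/ξ = 1 for every n ∈ ℤ. -/

import Mathlib

open MeasureTheory Complex
open scoped FourierTransform SchwartzMap

theorem ae_eq_of_integral_schwartzMap_smul_eq {f g : ℝ → ℂ} (hf : LocallyIntegrable f)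
    (hg : LocallyIntegrable g) (h : ∀ φ : 𝓢(ℝ, ℂ), ∫ x, φ x • f x = ∫ x, φ x • g x) :
    f =ᵐ[volume] g := by
  refine ae_eq_of_integral_contDiff_smul_eq hf hg fun φ hφ hφc => ?_
  have hφc' : HasCompactSupport (Complex.ofRealCLM ∘ φ) := hφc.comp_left rfl
  have hφ' : ContDiff ℝ (⊤ : ℕ∞) (Complex.ofRealCLM ∘ φ) := by fun_prop
  simpa using h (hφc'.toSchwartzMap hφ')

theorem integral_schwartzMap_fourier_smul (φ : 𝓢(ℝ, ℂ)) {f : ℝ → ℂ} (hf : Integrable f) :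
    ∫ x, (𝓕 φ) x • f x = ∫ x, φ x • 𝓕 f x := by
  have := VectorFourier.integral_fourierIntegral_smul_eq_flip (L := innerₗ ℝ)
    (μ := volume) (ν := volume) (f := φ) (g := f) Real.continuous_fourierChar
    continuous_inner φ.integrable hf
  rw [flip_innerₗ] at this
  exact this

theorem continuous_fourier_of_integrable {f : ℝ → ℂ} (hf : Integrable f) : Continuous (𝓕 f) :=
  VectorFourier.fourierIntegral_continuous Real.continuous_fourierChar continuous_inner hf

/-- Plancherel's theorem for integrable functions, where both sides may be infinite. -/
theorem eLpNorm_fourier_eq_of_integrable {f : ℝ → ℂ} (hf : Integrable f) :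
    eLpNorm (𝓕 f) 2 volume = eLpNorm f 2 volume := by
  have hcont := continuous_fourier_of_integrable hf
  by_cases hf2 : MemLp f 2 volume
  · have key : 𝓕 f =ᵐ[volume] (𝓕 (hf2.toLp f) : Lp (α := ℝ) ℂ 2 volume) := by
      refine ae_eq_of_integral_schwartzMap_smul_eq hcont.locallyIntegrable
        ((Lp.memLp _).locallyIntegrable one_le_two) fun φ => ?_
      rw [← Lp.toTemperedDistribution_apply, ← Lp.fourier_toTemperedDistribution_eq,
        TemperedDistribution.fourier_apply, Lp.toTemperedDistribution_apply,
        ← integral_schwartzMap_fourier_smul φ hf]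
      refine integral_congr_ae ?_
      filter_upwards [hf2.coeFn_toLp] with x hx
      rw [hx]
    rw [eLpNorm_congr_ae key, ← Lp.enorm_def, ← Lp.enorm_toLp (hf := hf2)]
    simp only [← ofReal_norm, Lp.norm_fourier_eq]
  · by_cases hF2 : MemLp (𝓕 f) 2 volume
    · have key : f =ᵐ[volume] (𝓕⁻ (hF2.toLp (𝓕 f)) : Lp (α := ℝ) ℂ 2 volume) := by
        refine ae_eq_of_integral_schwartzMap_smul_eq hf.locallyIntegrable
          ((Lp.memLp _).locallyIntegrable one_le_two) fun φ => ?_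
        rw [← Lp.toTemperedDistribution_apply, ← Lp.fourierInv_toTemperedDistribution_eq,
          TemperedDistribution.fourierInv_apply, Lp.toTemperedDistribution_apply]
        have := integral_schwartzMap_fourier_smul (𝓕⁻ φ) hf
        rw [FourierTransform.fourier_fourierInv_eq] at this
        rw [this]
        refine integral_congr_ae ?_
        filter_upwards [hF2.coeFn_toLp] with x hx
        rw [hx]
      exact absurd ((memLp_congr_ae key).2 (Lp.memLp _)) hf2
    · have h1 : eLpNorm (𝓕 f) 2 volume = ⊤ := by
        by_contra h
        exact hF2 ⟨hcont.aestronglyMeasurable, lt_top_iff_ne_top.2 h⟩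
      have h2 : eLpNorm f 2 volume = ⊤ := by
        by_contra h
        exact hf2 ⟨hf.aestronglyMeasurable, lt_top_iff_ne_top.2 h⟩
      rw [h1, h2]

theorem lintegral_enorm_fourier_sq_of_integrable {f : ℝ → ℂ} (hf : Integrable f) :
    ∫⁻ x, ‖𝓕 f x‖ₑ ^ 2 = ∫⁻ x, ‖f x‖ₑ ^ 2 := by
  have h (g : ℝ → ℂ) : eLpNorm g 2 volume ^ 2 = ∫⁻ x, ‖g x‖ₑ ^ 2 := by
    have := eLpNorm_nnreal_pow_eq_lintegral (μ := volume) (f := g) (p := 2) two_ne_zero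
    simpa using this
  rw [← h, ← h, eLpNorm_fourier_eq_of_integrable hf]

theorem lintegral_enorm_fourierInv_sq_of_integrable {f : ℝ → ℂ} (hf : Integrable f) :
    ∫⁻ x, ‖𝓕⁻ f x‖ₑ ^ 2 = ∫⁻ x, ‖f x‖ₑ ^ 2 := by
  rw [← lintegral_enorm_fourier_sq_of_integrable hf,
    ← lintegral_neg_eq_self (fun x => ‖𝓕 f x‖ₑ ^ 2)]
  simp only [Real.fourierInv_eq_fourier_neg]

/-- The wavelet coefficients on the frequency side. -/
noncomputable def waveletCoeff (u v : ℝ → ℂ) (b a : ℝ) : ℂ :=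
  ∫ ξ : ℝ, v ξ * (starRingEnd ℂ) ((Real.sqrt a : ℂ) * u (a * ξ)) *
    Complex.exp (2 * Real.pi * Complex.I * b * ξ)

/-- The Calderón constant of a function on the frequency side. -/
noncomputable def calderonConstant (u : ℝ → ℂ) : ENNReal :=
  ∫⁻ ξ in Set.Ioi (0 : ℝ), ENNReal.ofReal (1 / ξ) * ‖u ξ‖ₑ ^ 2

theorem memLp_two_of_lintegral_ne_top {u : ℝ → ℂ} (hu : Measurable u)
    (h : ∫⁻ ξ, ‖u ξ‖ₑ ^ 2 ≠ ⊤) : MemLp u 2 volume := by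
  refine ⟨hu.aestronglyMeasurable, ?_⟩
  have := eLpNorm_nnreal_pow_eq_lintegral (μ := volume) (f := u) (p := 2) two_ne_zero
  by_contra hc
  rw [not_lt, top_le_iff] at hc
  simp_all

theorem integrable_mul_conj_dilation {u v : ℝ → ℂ} (hu : MemLp u 2 volume)
    (hv : MemLp v 2 volume) {a : ℝ} (ha : 0 < a) :
    Integrable fun ξ => v ξ * (starRingEnd ℂ) ((Real.sqrt a : ℂ) * u (a * ξ)) := by
  have hua : MemLp (fun ξ => u (a * ξ)) 2 volume := by
    refine MemLp.comp_of_map (g := u) (f := fun ξ => a * ξ) ?_ (by fun_prop)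
    rw [Real.map_volume_mul_left ha.ne']
    exact hu.smul_measure ENNReal.ofReal_ne_top
  exact hv.integrable_mul (hua.const_mul _).star

theorem lintegral_enorm_waveletCoeff_sq {u v : ℝ → ℂ} (hu : MemLp u 2 volume)
    (hv : MemLp v 2 volume) {a : ℝ} (ha : 0 < a) :
    ∫⁻ b, ‖waveletCoeff u v b a‖ₑ ^ 2
      = ∫⁻ ξ, ENNReal.ofReal a * (‖v ξ‖ₑ ^ 2 * ‖u (a * ξ)‖ₑ ^ 2) := by
  have hW (b : ℝ) : waveletCoeff u v b a
      = 𝓕⁻ (fun ξ => v ξ * (starRingEnd ℂ) ((Real.sqrt a : ℂ) * u (a * ξ))) b := by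
    rw [Real.fourierInv_eq', waveletCoeff]
    refine integral_congr_ae (.of_forall fun ξ => ?_)
    simp only [smul_eq_mul]
    rw [mul_comm]
    congr 2
    simp
    ring
  simp only [hW,
    lintegral_enorm_fourierInv_sq_of_integrable (integrable_mul_conj_dilation hu hv ha)]
  refine lintegral_congr fun ξ => ?_
  have hs : ‖(Real.sqrt a : ℂ)‖ₑ ^ 2 = ENNReal.ofReal a := by
    rw [← ofReal_norm, ← ENNReal.ofReal_pow (norm_nonneg _)]
    simp [Real.sq_sqrt ha.le]
  rw [enorm_mul, RCLike.enorm_conj, enorm_mul, mul_pow, mul_pow, hs]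
  ring

theorem lintegral_dilation_eq_calderonConstant (u : ℝ → ℂ) {ξ : ℝ} (hξ : 0 < ξ) :
    ∫⁻ a in Set.Ioi (0 : ℝ), ENNReal.ofReal (1 / a) * ‖u (a * ξ)‖ₑ ^ 2
      = calderonConstant u := by
  have himg : (fun a => a * ξ) '' Set.Ioi (0 : ℝ) = Set.Ioi 0 := by
    simp_rw [mul_comm _ ξ, Set.image_mul_left_Ioi hξ, mul_zero]
  have := lintegral_image_eq_lintegral_abs_deriv_mul (s := Set.Ioi (0 : ℝ))
    (f := fun a => a * ξ) (f' := fun _ => ξ) measurableSet_Ioi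
    (fun x _ => by simpa using ((hasDerivAt_id x).mul_const ξ).hasDerivWithinAt)
    (mul_left_injective₀ hξ.ne').injOn (fun η => ENNReal.ofReal (1 / η) * ‖u η‖ₑ ^ 2)
  rw [himg] at this
  rw [calderonConstant, this]
  refine setLIntegral_congr_fun measurableSet_Ioi fun a ha => ?_
  have ha : 0 < a := ha
  rw [← mul_assoc, ← ENNReal.ofReal_mul (abs_nonneg _), abs_of_pos hξ]
  congr 3
  field_simp

/-- The Calderón reproducing identity. -/
theorem lintegral_waveletCoeff_eq {u v : ℝ → ℂ} (hum : Measurable u) (hvm : Measurable v)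
    (hu : ∫⁻ ξ, ‖u ξ‖ₑ ^ 2 ≠ ⊤) (hv : ∫⁻ ξ, ‖v ξ‖ₑ ^ 2 ≠ ⊤)
    (hvsupp : ∀ ξ, ξ ∉ Set.Ioi (0 : ℝ) → v ξ = 0) :
    ∫⁻ a in Set.Ioi (0 : ℝ), (∫⁻ b, ‖waveletCoeff u v b a‖ₑ ^ 2) * ENNReal.ofReal (1 / a ^ 2)
      = (∫⁻ ξ, ‖v ξ‖ₑ ^ 2) * calderonConstant u := by
  have hu2 := memLp_two_of_lintegral_ne_top hum hu
  have hv2 := memLp_two_of_lintegral_ne_top hvm hv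
  calc
    _ = ∫⁻ a in Set.Ioi (0 : ℝ), ∫⁻ ξ,
          ‖v ξ‖ₑ ^ 2 * (ENNReal.ofReal (1 / a) * ‖u (a * ξ)‖ₑ ^ 2) := by
      refine setLIntegral_congr_fun measurableSet_Ioi fun a ha => ?_
      have ha : 0 < a := ha
      rw [lintegral_enorm_waveletCoeff_sq hu2 hv2 ha, ← lintegral_mul_const _ (by fun_prop)]
      refine lintegral_congr fun ξ => ?_
      rw [show (1 : ℝ) / a = a * (1 / a ^ 2) by field_simp, ENNReal.ofReal_mul ha.le]
      ring
    _ = ∫⁻ ξ, ∫⁻ a in Set.Ioi (0 : ℝ),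
          ‖v ξ‖ₑ ^ 2 * (ENNReal.ofReal (1 / a) * ‖u (a * ξ)‖ₑ ^ 2) :=
      lintegral_lintegral_swap (by fun_prop)
    _ = ∫⁻ ξ, ‖v ξ‖ₑ ^ 2 * calderonConstant u := by
      refine lintegral_congr fun ξ => ?_
      rw [lintegral_const_mul _ (by fun_prop)]
      by_cases hξ : ξ ∈ Set.Ioi (0 : ℝ)
      · rw [lintegral_dilation_eq_calderonConstant u hξ]
      · simp [hvsupp ξ hξ]
    _ = _ := lintegral_mul_const _ (by fun_prop)

theorem calderonConstant_eq_one_iff {u : ℝ → ℂ} (hum : Measurable u) :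
    calderonConstant u = 1 ↔ ∫ ξ in Set.Ioi (0 : ℝ), ‖u ξ‖ ^ 2 / ξ = 1 := by
  have h : calderonConstant u
      = ∫⁻ ξ in Set.Ioi (0 : ℝ), ENNReal.ofReal (‖u ξ‖ ^ 2 / ξ) := by
    refine setLIntegral_congr_fun measurableSet_Ioi fun ξ hξ => ?_
    have hξ : 0 < ξ := hξ
    rw [← ofReal_norm, ← ENNReal.ofReal_pow (norm_nonneg _),
      ← ENNReal.ofReal_mul (by positivity)]
    congr 1
    ring
  have hm : Measurable fun ξ => ‖u ξ‖ ^ 2 / ξ := (hum.norm.pow_const 2).div measurable_id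
  rw [integral_eq_lintegral_of_nonneg_ae
    (ae_restrict_of_forall_mem measurableSet_Ioi fun ξ (hξ : 0 < ξ) => by positivity)
    hm.aestronglyMeasurable, ← h, ENNReal.toReal_eq_one_iff]

/-- Admissibility for the Schrödingerlet representation `π = w ⊗ λ` of
`G = (ℝ ⋊ ℝ₊) × S¹` on `H = F⁻¹L²(ℝ̂₊) ⊗ L²(S¹)`.  Vectors of `H` are described on the
frequency side by their sequence of Fourier components `(V n)_{n ∈ ℤ}`, supported in
`(0,∞)`, with `‖v‖² = Σₙ ∫ |V n|²` (Plancherel).  The voice transform decomposes as the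
Fourier series `Vv(b,a,φ) = Σₙ Wₙ(b,a) e^{inφ}` with wavelet coefficients
`Wₙ(b,a) = ∫_{ℝ₊} Vₙ(ξ) conj(√a Uₙ(aξ)) e^{2πibξ} dξ`, so that its `L²(G)` norm (with Haar
measure `db da/a² dφ/2π`) is `Σₙ ∬ |Wₙ(b,a)|² db da/a²`.  Then `u = Σ uₙ ⊗ eₙ ∈ H` is
admissible (the voice transform is an isometry into `L²(G)`) if and only if the Calderón
conditions `∫_{ℝ₊} |F uₙ(ξ)|² dξ/ξ = 1` hold for every `n ∈ ℤ`. -/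
theorem schrodingerlets_admissible_iff
    (U : ℤ → ℝ → ℂ)
    (hUmeas : ∀ n, Measurable (U n))
    (hUsupp : ∀ n ξ, ξ ∉ Set.Ioi (0 : ℝ) → U n ξ = 0)
    (hUmem : (∑' n : ℤ, ∫⁻ ξ : ℝ, (‖U n ξ‖₊ : ENNReal) ^ 2 ∂volume) ≠ ⊤)
    (W : (ℤ → ℝ → ℂ) → ℤ → ℝ → ℝ → ℂ)
    (hW : W = fun (V : ℤ → ℝ → ℂ) (n : ℤ) (b a : ℝ) =>
      ∫ ξ : ℝ, V n ξ * (starRingEnd ℂ) ((Real.sqrt a : ℂ) * U n (a * ξ)) *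
        Complex.exp (2 * Real.pi * Complex.I * b * ξ) ∂volume) :
    (∀ V : ℤ → ℝ → ℂ, (∀ n, Measurable (V n)) →
      (∀ n ξ, ξ ∉ Set.Ioi (0 : ℝ) → V n ξ = 0) →
      (∑' n : ℤ, ∫⁻ ξ : ℝ, (‖V n ξ‖₊ : ENNReal) ^ 2 ∂volume) ≠ ⊤ →
      (∑' n : ℤ, ∫⁻ a in Set.Ioi (0 : ℝ),
          (∫⁻ b : ℝ, (‖W V n b a‖₊ : ENNReal) ^ 2 ∂volume) *
            ENNReal.ofReal (1 / a ^ 2) ∂volume)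
        = ∑' n : ℤ, ∫⁻ ξ : ℝ, (‖V n ξ‖₊ : ENNReal) ^ 2 ∂volume) ↔
      (∀ n : ℤ, ∫ ξ in Set.Ioi (0 : ℝ), ‖U n ξ‖ ^ 2 / ξ ∂volume = 1) := by
  have hWc (V : ℤ → ℝ → ℂ) (n : ℤ) (b a : ℝ) : W V n b a = waveletCoeff (U n) (V n) b a := by
    rw [hW, waveletCoeff]
  simp only [hWc, ← enorm_eq_nnnorm, ← calderonConstant_eq_one_iff (hUmeas _)] at hUmem ⊢
  have hU (n : ℤ) := ENNReal.ne_top_of_tsum_ne_top hUmem n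
  constructor
  · intro h m
    let V : ℤ → ℝ → ℂ := Pi.single m ((Set.Ioc 0 1).indicator 1)
    have hVm (n : ℤ) : Measurable (V n) := by
      obtain rfl | hn := eq_or_ne n m
      · simpa [V] using measurable_one.indicator measurableSet_Ioc
      · simpa [V, hn] using measurable_zero
    have hVsupp (n : ℤ) (ξ : ℝ) (hξ : ξ ∉ Set.Ioi (0 : ℝ)) : V n ξ = 0 := by
      obtain rfl | hn := eq_or_ne n m
      · simp only [V, Pi.single_eq_same]
        exact Set.indicator_of_notMem (fun hmem => hξ hmem.1) _
      · simp [V, hn]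
    have hVn (n : ℤ) (hn : n ≠ m) : ∫⁻ ξ, ‖V n ξ‖ₑ ^ 2 = 0 := by simp [V, hn]
    have hVm1 : ∫⁻ ξ, ‖V m ξ‖ₑ ^ 2 = 1 := by
      have : (fun ξ => ‖V m ξ‖ₑ ^ 2) = (Set.Ioc (0 : ℝ) 1).indicator 1 := by
        funext ξ
        by_cases hξ : ξ ∈ Set.Ioc (0 : ℝ) 1 <;> simp [V, Set.indicator, hξ]
      rw [this, lintegral_indicator_one measurableSet_Ioc]
      simp
    have hVsum : ∑' n, ∫⁻ ξ, ‖V n ξ‖ₑ ^ 2 = 1 := by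
      rw [tsum_eq_single m hVn, hVm1]
    have hVtop : ∑' n, ∫⁻ ξ, ‖V n ξ‖ₑ ^ 2 ≠ ⊤ := by simp [hVsum]
    have key := h V hVm hVsupp hVtop
    simp only [lintegral_waveletCoeff_eq (hUmeas _) (hVm _) (hU _)
      (ENNReal.ne_top_of_tsum_ne_top hVtop _) (hVsupp _)] at key
    rwa [hVsum, tsum_eq_single m fun n hn => by rw [hVn n hn, zero_mul], hVm1, one_mul] at key
  · intro h V hVm hVsupp hVtop
    refine tsum_congr fun n => ?_
    rw [lintegral_waveletCoeff_eq (hUmeas n) (hVm n) (hU n)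
      (ENNReal.ne_top_of_tsum_ne_top hVtop n) (hVsupp n), h n, mul_one]
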